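/- arXiv:1001.2193 — 3 statements merged into one kernel-verified Lean document; each statement's English description precedes it below -/
import Mathlib

section
/- Every G-set Γ has at most one y-valley and at most one z-valley; in particular a G-set has 0, 1 or 2 valleys in total. -/
open scoped BigOperators Classical

namespace GH

/-- Exponent vectors of monomials `x^m y^n z^p`. -/
abbrev N3 : Type := ℕ × ℕ × ℕ

/-- The lattice `ℤ³`. -/
abbrev Z3 : Type := ℤ × ℤ × ℤ

/-- Inclusion `ℕ³ → ℤ³`. -/
def toZ (v : N3) : Z3 := ((v.1 : ℤ), (v.2.1 : ℤ), (v.2.2 : ℤ))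

/-- The weight map `wt(m,n,p) = m + a·n + (r−a)·p (mod r)` on `ℤ³`. -/
def wtZ (r a : ℕ) (v : Z3) : ZMod r :=
  (v.1 : ZMod r) + (a : ZMod r) * (v.2.1 : ZMod r) + ((r - a : ℕ) : ZMod r) * (v.2.2 : ZMod r)

/-- The weight map on `ℕ³`. -/
def wtN (r a : ℕ) (v : N3) : ZMod r := wtZ r a (toZ v)

/-- A `G`-set: contains the origin, closed under taking summands, and the weight map
restricted to it is a bijection onto `ℤ/rℤ`. -/
structure IsGSet (r a : ℕ) (Γ : Set N3) : Prop where
  zero_mem : (0, 0, 0) ∈ Γ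
  dclosed : ∀ u v : N3, u + v ∈ Γ → u ∈ Γ ∧ v ∈ Γ
  bij : Set.BijOn (wtN r a) Γ Set.univ

/-- `wt_Γ(v)`: the (unique, for a `G`-set) element of `Γ` of the same weight as `v`. -/
noncomputable def wtG (r a : ℕ) (Γ : Set N3) (v : N3) : N3 :=
  if h : ∃ w, w ∈ Γ ∧ wtN r a w = wtN r a v then h.choose else (0, 0, 0)

/-- `(m,n)` is a y-valley of `Γ`. -/
def IsYValley (Γ : Set N3) (m n : ℕ) : Prop :=
  (m, n, 0) ∈ Γ ∧ (m + 1, n, 0) ∈ Γ ∧ (m, n + 1, 0) ∈ Γ ∧ (m + 1, n + 1, 0) ∉ Γ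

/-- `(m,n)` is a z-valley of `Γ`. -/
def IsZValley (Γ : Set N3) (m n : ℕ) : Prop :=
  (m, 0, n) ∈ Γ ∧ (m + 1, 0, n) ∈ Γ ∧ (m, 0, n + 1) ∈ Γ ∧ (m + 1, 0, n + 1) ∉ Γ

/-- A primitive `G`-set: it has a y-valley `(i_y, 0)` and a z-valley `(i_z, 0)`. -/
def IsPrimG (Γ : Set N3) : Prop := (∃ p : ℕ, IsYValley Γ p 0) ∧ (∃ p : ℕ, IsZValley Γ p 0)

/-- `s_Γ(v) = v − wt_Γ(v) ∈ ℤ³`. -/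
noncomputable def sG (r a : ℕ) (Γ : Set N3) (v : N3) : Z3 := toZ v - toZ (wtG r a Γ v)

/-- The submonoid `S(Γ)` of `ℤ³` generated by all `s_Γ(v)`. -/
noncomputable def SMon (r a : ℕ) (Γ : Set N3) : AddSubmonoid Z3 :=
  AddSubmonoid.closure (Set.range (sG r a Γ))

/-- The lattice `M = { u ∈ ℤ³ : wt(u) = 0 }` of `G`-invariant monomials. -/
def latM (r a : ℕ) : Set Z3 := { u | wtZ r a u = 0 }

/-- The standard pairing of `ℝ³` with `ℤ³`. -/
def dotR (α : ℝ × ℝ × ℝ) (u : Z3) : ℝ :=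
  α.1 * (u.1 : ℝ) + α.2.1 * (u.2.1 : ℝ) + α.2.2 * (u.2.2 : ℝ)

/-- The cone `σ(Γ) = { α ∈ ℝ³ : ⟨α, s_Γ(v)⟩ ≥ 0 for all v ∈ ℕ³ }`. -/
noncomputable def sigmaCone (r a : ℕ) (Γ : Set N3) : Set (ℝ × ℝ × ℝ) :=
  { α | ∀ v : N3, 0 ≤ dotR α (sG r a Γ v) }

/-- `span(u₁,…,u_t)`: all `v ∈ ℕ³` dominated componentwise by some `u_s`. -/
def spanSet (s : Set N3) : Set N3 := { v | ∃ u ∈ s, v ≤ u }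

/-- `i(Γ)`: the largest `m` with `(m,0,0) ∈ Γ`. -/
noncomputable def iOf (Γ : Set N3) : ℕ := sSup { m : ℕ | (m, 0, 0) ∈ Γ }

/-- `j(Γ)`: the largest `n` with `(0,n,0) ∈ Γ`. -/
noncomputable def jOf (Γ : Set N3) : ℕ := sSup { n : ℕ | (0, n, 0) ∈ Γ }

/-- `k(Γ)`: the largest `p` with `(0,0,p) ∈ Γ`. -/
noncomputable def kOf (Γ : Set N3) : ℕ := sSup { p : ℕ | (0, 0, p) ∈ Γ }

/-- `c(w) = max { c : w − c·v ∈ ℕ³ }` (componentwise). -/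
noncomputable def cmax (v w : N3) : ℕ := sSup { c : ℕ | c • v ≤ w }

/-- The `G`-igsaw transformation of `Γ` in the direction of `u`:
`T_u(Γ) = { w + c(w)·(u − v) : w ∈ Γ }` where `v = wt_Γ(u)`. -/
noncomputable def jig (r a : ℕ) (Γ : Set N3) (u : N3) : Set N3 :=
  { w' | ∃ w ∈ Γ,
      toZ w' = toZ w + (cmax (wtG r a Γ u) w) • (toZ u - toZ (wtG r a Γ u)) }

/-- The upper transformation `TU(Γ)`. -/
noncomputable def TU (r a : ℕ) (Γ : Set N3) : Set N3 := jig r a Γ (iOf Γ + 1, 0, 0)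

/-- The right transformation `TR(Γ)`. -/
noncomputable def TR (r a : ℕ) (Γ : Set N3) : Set N3 := jig r a Γ (0, jOf Γ + 1, 0)

/-- The left transformation `TL(Γ)`. -/
noncomputable def TL (r a : ℕ) (Γ : Set N3) : Set N3 := jig r a Γ (0, 0, kOf Γ + 1)

/-- The y-valley of `Γ` (chosen by choice; unique for a `G`-set having one). -/
noncomputable def yValley (Γ : Set N3) : ℕ × ℕ :=
  if h : ∃ p : ℕ × ℕ, IsYValley Γ p.1 p.2 then h.choose else (0, 0)

/-- The z-valley of `Γ` (chosen by choice; unique for a `G`-set having one). -/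
noncomputable def zValley (Γ : Set N3) : ℕ × ℕ :=
  if h : ∃ p : ℕ × ℕ, IsZValley Γ p.1 p.2 then h.choose else (0, 0)

/-- The upper right transformation `TUR(Γ)`, in the direction `(i_y+1, j_y+1, 0)`. -/
noncomputable def TUR (r a : ℕ) (Γ : Set N3) : Set N3 :=
  jig r a Γ ((yValley Γ).1 + 1, (yValley Γ).2 + 1, 0)

/-- The upper left transformation `TUL(Γ)`, in the direction `(i_z+1, 0, k_z+1)`. -/
noncomputable def TUL (r a : ℕ) (Γ : Set N3) : Set N3 :=
  jig r a Γ ((zValley Γ).1 + 1, 0, (zValley Γ).2 + 1)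

/-- The bound `min{j, k, j − j_y, k − k_z}` for the triangle of transformations. -/
noncomputable def minBound (Γ : Set N3) : ℕ :=
  min (min (jOf Γ) (kOf Γ)) (min (jOf Γ - (yValley Γ).2) (kOf Γ - (zValley Γ).2))

/-- The triangle of transformations `Θ(Γ)`. -/
noncomputable def Theta (r a : ℕ) (Γ : Set N3) : Set (Set N3) :=
  { Γ' | ∃ p q : ℕ, p + q ≤ minBound Γ ∧ Γ' = (TUR r a)^[p] ((TUL r a)^[q] Γ) }

/-- The recursion step producing `Γ_{n+1}` from `Γ_n`. -/
noncomputable def nextGamma (r a : ℕ) (Γ : Set N3) : Set N3 :=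
  if jOf Γ < kOf Γ then TU r a ((TUR r a)^[jOf Γ] Γ)
  else TU r a ((TUL r a)^[kOf Γ] Γ)

/-- The sequence of primitive `G`-sets; `GammaSeq r a b (n-1)` is `Γ_n`,
starting from `Γ₁ = span((1,0,0),(0,b−1,0),(0,0,r−b−1))`. -/
noncomputable def GammaSeq (r a b : ℕ) : ℕ → Set N3
  | 0 => spanSet {(1, 0, 0), (0, b - 1, 0), (0, 0, r - b - 1)}
  | n + 1 => nextGamma r a (GammaSeq r a b n)


theorem wtN_apply {r a : ℕ} (h : a ≤ r) (m n p : ℕ) :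
    wtN r a (m, n, p) = (m : ZMod r) + a * n - a * p := by
  simp only [wtN, wtZ, toZ, Nat.cast_sub h, ZMod.natCast_self]
  push_cast
  ring

/-- A `G`-set contains every monomial dividing one of its members. -/
theorem IsGSet.mem_of_le {r a : ℕ} {Γ : Set N3} (hΓ : IsGSet r a Γ) {u w : N3}
    (hw : w ∈ Γ) (h : u ≤ w) : u ∈ Γ := by
  obtain ⟨v, rfl⟩ := exists_add_of_le h
  exact (hΓ.dclosed u v hw).1

/-- Exchanging `y` and `z` turns `G`-sets for `a` into `G`-sets for `r - a`. -/
theorem IsGSet.swap {r a : ℕ} (h : a ≤ r) {Γ : Set N3} (hΓ : IsGSet r a Γ) :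
    IsGSet r (r - a) {v | (v.1, v.2.2, v.2.1) ∈ Γ} := by
  have hwt : ∀ v : N3, wtN r (r - a) v = wtN r a (v.1, v.2.2, v.2.1) := by
    rintro ⟨m, n, p⟩
    rw [wtN_apply h, wtN_apply (Nat.sub_le r a), Nat.cast_sub h, ZMod.natCast_self]
    ring
  refine ⟨hΓ.zero_mem, fun u v huv => hΓ.dclosed (u.1, u.2.2, u.2.1) (v.1, v.2.2, v.2.1) huv,
    fun _ _ => Set.mem_univ _, ?_, ?_⟩
  · rintro ⟨m, n, p⟩ hu ⟨m', n', p'⟩ hv huv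
    rw [hwt, hwt] at huv
    have := hΓ.bij.injOn hu hv huv
    simp only [Prod.mk.injEq] at this ⊢
    tauto
  · intro c _
    obtain ⟨⟨m, n, p⟩, hw, rfl⟩ := hΓ.bij.surjOn (Set.mem_univ c)
    exact ⟨(m, p, n), hw, hwt _⟩

/-- At a y-valley `(m, n)`, the monomial `x^(m+1) y^(n+1)` has the weight of the highest power
of `z` in the `G`-set. -/
theorem IsYValley.exists_wtN_eq {r a : ℕ} (h : a ≤ r) {Γ : Set N3} (hΓ : IsGSet r a Γ) {m n : ℕ}
    (hv : IsYValley Γ m n) :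
    ∃ p : ℕ, (0, 0, p) ∈ Γ ∧ (0, 0, p + 1) ∉ Γ ∧
      wtN r a (0, 0, p) = wtN r a (m + 1, n + 1, 0) := by
  obtain ⟨-, hx, hy, hxy⟩ := hv
  obtain ⟨⟨s, q, p⟩, hw, hwt⟩ := hΓ.bij.surjOn (Set.mem_univ (wtN r a (m + 1, n + 1, 0)))
  have hwt' := hwt
  rw [wtN_apply h, wtN_apply h] at hwt'
  push_cast at hwt'
  obtain _ | s := s
  · obtain _ | q := q
    · refine ⟨p, hw, fun hp => ?_, hwt⟩
      have := hΓ.bij.injOn hp hx (by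
        rw [wtN_apply h, wtN_apply h]
        push_cast at hwt' ⊢
        linear_combination hwt')
      simp at this
    · have := hΓ.bij.injOn (hΓ.mem_of_le (u := (0, q, p)) hw (by simp [Prod.le_def])) hx (by
        rw [wtN_apply h, wtN_apply h]
        push_cast at hwt' ⊢
        linear_combination hwt')
      simp at this
  · have := hΓ.bij.injOn (hΓ.mem_of_le (u := (s, q, p)) hw (by simp [Prod.le_def])) hy (by
      rw [wtN_apply h, wtN_apply h]
      push_cast at hwt' ⊢
      linear_combination hwt')
    simp only [Prod.mk.injEq] at this
    obtain ⟨rfl, rfl, rfl⟩ := this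
    exact absurd hw hxy

/-- A `G`-set has at most one y-valley. -/
theorem IsYValley.unique {r a : ℕ} (h : a ≤ r) {Γ : Set N3} (hΓ : IsGSet r a Γ) {m n m' n' : ℕ}
    (hv : IsYValley Γ m n) (hv' : IsYValley Γ m' n') : m = m' ∧ n = n' := by
  obtain ⟨p, hp, hp1, hwt⟩ := hv.exists_wtN_eq h hΓ
  obtain ⟨p', hp', hp1', hwt'⟩ := hv'.exists_wtN_eq h hΓ
  obtain rfl : p = p' := by
    rcases lt_trichotomy p p' with hlt | heq | hlt
    · exact absurd (hΓ.mem_of_le hp' (by simpa [Prod.le_def] using hlt)) hp1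
    · exact heq
    · exact absurd (hΓ.mem_of_le hp (by simpa [Prod.le_def] using hlt)) hp1'
  have heq := hwt.symm.trans hwt'
  have := hΓ.bij.injOn hv.2.2.1 hv'.2.2.1 (by
    rw [wtN_apply h, wtN_apply h] at heq ⊢
    push_cast at heq ⊢
    linear_combination heq)
  simpa using this

/-- Every `G`-set has at most one y-valley and at most one z-valley;
in particular it has 0, 1 or 2 valleys. -/
theorem stmt0 (r a : ℕ) (hra : Nat.Coprime r a) (ha2 : 2 ≤ a) (halt : a < r - a) (Γ : Set N3) (hΓ : IsGSet r a Γ) :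
    (∀ m n m' n' : ℕ, IsYValley Γ m n → IsYValley Γ m' n' → m = m' ∧ n = n') ∧
    (∀ m n m' n' : ℕ, IsZValley Γ m n → IsZValley Γ m' n' → m = m' ∧ n = n') := by
  have h : a ≤ r := by omega
  exact ⟨fun _ _ _ _ hv hv' => hv.unique h hΓ hv',
    fun m n m' n' (hv : IsYValley {v | (v.1, v.2.2, v.2.1) ∈ Γ} m n)
      (hv' : IsYValley {v | (v.1, v.2.2, v.2.1) ∈ Γ} m' n') =>
      hv.unique (Nat.sub_le r a) (hΓ.swap h) hv'⟩

end GH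
end

section
/- Suppose a G-set Γ has exactly two valleys, the y-valley (i_y,j_y) and the z-valley (i_z,k_z). Then wt_Γ((0,j+1,0)) = (i_z+1, 0, k_z) and wt_Γ((0,0,k+1)) = (i_y+1, j_y, 0), where j = j(Γ) and k = k(Γ). -/
open scoped BigOperators Classical

namespace GH

theorem wtN_add (r a : ℕ) (u v : N3) : wtN r a (u + v) = wtN r a u + wtN r a v := by
  simp only [wtN, wtZ, toZ, Prod.fst_add, Prod.snd_add]
  push_cast
  ring

/-- Multiplying a monomial by `y z` does not change its weight. -/
theorem wtN_add_yz {r a : ℕ} (h : a ≤ r) (u : N3) : wtN r a (u + (0, 1, 1)) = wtN r a u := by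
  rw [wtN_add]
  simp [wtN, wtZ, toZ, Nat.cast_sub h]

namespace IsGSet

variable {r a : ℕ} {Γ : Set N3}

theorem mem_of_le_s2 (hΓ : IsGSet r a Γ) {u v : N3} (hv : v ∈ Γ) (h : u ≤ v) : u ∈ Γ := by
  obtain ⟨w, rfl⟩ := exists_add_of_le h
  exact (hΓ.dclosed u w hv).1

theorem eq_of_wtN_eq (hΓ : IsGSet r a Γ) {u v : N3} (hu : u ∈ Γ) (hv : v ∈ Γ)
    (h : wtN r a u = wtN r a v) : u = v :=
  hΓ.bij.injOn hu hv h

theorem wtG_eq (hΓ : IsGSet r a Γ) {v w : N3} (hw : w ∈ Γ) (h : wtN r a w = wtN r a v) :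
    wtG r a Γ v = w := by
  have hex : ∃ w, w ∈ Γ ∧ wtN r a w = wtN r a v := ⟨w, hw, h⟩
  rw [wtG, dif_pos hex]
  exact hΓ.eq_of_wtN_eq hex.choose_spec.1 hw (hex.choose_spec.2.trans h.symm)

/-- If `u + e ∉ Γ` with `u ∈ Γ`, then no element of `Γ` with the weight of `u + e` is
divisible by `e`. -/
theorem add_ne_of_wtN_eq (hΓ : IsGSet r a Γ) {u e w t : N3} (hu : u ∈ Γ) (hue : u + e ∉ Γ)
    (hw : w ∈ Γ) (h : wtN r a w = wtN r a (u + e)) : t + e ≠ w := by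
  rintro rfl
  have ht := (hΓ.dclosed t e hw).1
  rw [wtN_add, wtN_add, add_left_inj] at h
  exact hue (hΓ.eq_of_wtN_eq ht hu h ▸ hw)

theorem wtG_z_of_isYValley (hΓ : IsGSet r a Γ) (har : a ≤ r) {m n k : ℕ}
    (hv : IsYValley Γ m n) (hk : (0, 0, k) ∈ Γ) (hk' : (0, 0, k + 1) ∉ Γ) :
    wtG r a Γ (0, 0, k + 1) = (m + 1, n, 0) := by
  obtain ⟨-, hx, hy, hn⟩ := hv
  obtain ⟨⟨s, t, p⟩, hw, hwt⟩ := hΓ.bij.surjOn (Set.mem_univ (wtN r a (m + 1, n + 1, 0)))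
  obtain rfl : s = 0 := by
    by_contra hs
    exact hΓ.add_ne_of_wtN_eq (e := (1, 0, 0)) (t := (s - 1, t, p)) hy hn hw hwt
      (by ext <;> simp; omega)
  obtain rfl : t = 0 := by
    by_contra ht
    exact hΓ.add_ne_of_wtN_eq (e := (0, 1, 0)) (t := (0, t - 1, p)) hx hn hw hwt
      (by ext <;> simp; omega)
  have hwt' : wtN r a (m + 1, n, 0) = wtN r a (0, 0, p + 1) := by
    have h : wtN r a ((0, 0, p) + (0, 0, 1)) = wtN r a ((m + 1, n + 1, 0) + (0, 0, 1)) := by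
      rw [wtN_add, hwt, ← wtN_add]
    exact ((wtN_add_yz har (m + 1, n, 0)).symm.trans h.symm)
  have hp : (0, 0, p + 1) ∉ Γ := fun h => by
    simpa using congrArg Prod.fst (hΓ.eq_of_wtN_eq hx h hwt')
  have hpk : p = k := by
    rcases lt_trichotomy p k with h | h | h
    · exact (hp (hΓ.mem_of_le_s2 hk (by simpa [Prod.le_def] using h))).elim
    · exact h
    · exact (hk' (hΓ.mem_of_le_s2 hw (by simpa [Prod.le_def] using h))).elim
  exact hΓ.wtG_eq hx (hpk ▸ hwt')

theorem wtG_y_of_isZValley (hΓ : IsGSet r a Γ) (har : a ≤ r) {m n j : ℕ}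
    (hv : IsZValley Γ m n) (hj : (0, j, 0) ∈ Γ) (hj' : (0, j + 1, 0) ∉ Γ) :
    wtG r a Γ (0, j + 1, 0) = (m + 1, 0, n) := by
  obtain ⟨-, hx, hz, hn⟩ := hv
  obtain ⟨⟨s, p, t⟩, hw, hwt⟩ := hΓ.bij.surjOn (Set.mem_univ (wtN r a (m + 1, 0, n + 1)))
  obtain rfl : s = 0 := by
    by_contra hs
    exact hΓ.add_ne_of_wtN_eq (e := (1, 0, 0)) (t := (s - 1, p, t)) hz hn hw hwt
      (by ext <;> simp; omega)
  obtain rfl : t = 0 := by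
    by_contra ht
    exact hΓ.add_ne_of_wtN_eq (e := (0, 0, 1)) (t := (0, p, t - 1)) hx hn hw hwt
      (by ext <;> simp; omega)
  have hwt' : wtN r a (m + 1, 0, n) = wtN r a (0, p + 1, 0) := by
    have h : wtN r a ((0, p, 0) + (0, 1, 0)) = wtN r a ((m + 1, 0, n + 1) + (0, 1, 0)) := by
      rw [wtN_add, hwt, ← wtN_add]
    exact ((wtN_add_yz har (m + 1, 0, n)).symm.trans h.symm)
  have hp : (0, p + 1, 0) ∉ Γ := fun h => by
    simpa using congrArg Prod.fst (hΓ.eq_of_wtN_eq hx h hwt')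
  have hpj : p = j := by
    rcases lt_trichotomy p j with h | h | h
    · exact (hp (hΓ.mem_of_le_s2 hj (by simpa [Prod.le_def] using h))).elim
    · exact h
    · exact (hj' (hΓ.mem_of_le_s2 hw (by simpa [Prod.le_def] using h))).elim
  exact hΓ.wtG_eq hx (hpj ▸ hwt')

end IsGSet

/-- Where the extremes go for a `G`-set with exactly two valleys. -/
theorem stmt2 (r a : ℕ) (hra : Nat.Coprime r a) (ha2 : 2 ≤ a) (halt : a < r - a) (Γ : Set N3) (hΓ : IsGSet r a Γ)
    (iy jy iz kz : ℕ)
    (hyv : IsYValley Γ iy jy) (hzv : IsZValley Γ iz kz)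
    (hyu : ∀ m n : ℕ, IsYValley Γ m n → (m, n) = (iy, jy))
    (hzu : ∀ m n : ℕ, IsZValley Γ m n → (m, n) = (iz, kz))
    (j k : ℕ)
    (hj : (0, j, 0) ∈ Γ ∧ (0, j + 1, 0) ∉ Γ)
    (hk : (0, 0, k) ∈ Γ ∧ (0, 0, k + 1) ∉ Γ) :
    wtG r a Γ (0, j + 1, 0) = (iz + 1, 0, kz) ∧
    wtG r a Γ (0, 0, k + 1) = (iy + 1, jy, 0) := by
  have har : a ≤ r := by omega
  exact ⟨hΓ.wtG_y_of_isZValley har hzv hj.1 hj.2, hΓ.wtG_z_of_isYValley har hyv hk.1 hk.2⟩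

end GH
end

section
/- Let Γ be a G-set with exactly two valleys, the y-valley (i_y,j_y) and the z-valley (i_z,k_z), and write i = i(Γ), j = j(Γ), k = k(Γ). Then i_y + i_z + 1 = i, and wt_Γ((i+1,0,0)) = (0, (j−j_y)−(k−k_z), 0) if (j−j_y) ≥ (k−k_z), while wt_Γ((i+1,0,0)) = (0, 0, (k−k_z)−(j−j_y)) otherwise. -/
open scoped BigOperators Classical

namespace GH

theorem wtN_eq {r a : ℕ} (h : a ≤ r) (m n p : ℕ) :
    wtN r a (m, n, p) = (m : ZMod r) + (a : ZMod r) * n - (a : ZMod r) * p := by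
  simp only [wtN, wtZ, toZ, Nat.cast_sub h, CharP.cast_eq_zero, Int.cast_natCast]
  ring

/-- A predicate on exponents describing a `G`-set for the weight `m + c·n - c·p`, where `c` is
any residue. This form is symmetric under exchanging `y` and `z`, replacing `c` by `-c`. -/
structure IsWeightSystem {r : ℕ} (c : ZMod r) (P : ℕ → ℕ → ℕ → Prop) : Prop where
  mono : ∀ {m n p m' n' p'}, P m n p → m' ≤ m → n' ≤ n → p' ≤ p → P m' n' p'
  inj : ∀ {m n p m' n' p'}, P m n p → P m' n' p' →
    (m : ZMod r) + c * n - c * p = m' + c * n' - c * p' → m = m' ∧ n = n' ∧ p = p'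
  surj : ∀ t : ZMod r, ∃ m n p, P m n p ∧ (m : ZMod r) + c * n - c * p = t

namespace IsWeightSystem

variable {r : ℕ} {c : ZMod r} {P : ℕ → ℕ → ℕ → Prop}

theorem swap (h : IsWeightSystem c P) : IsWeightSystem (-c) (fun m n p => P m p n) where
  mono hP hm hn hp := h.mono hP hm hp hn
  inj hP hP' e := by
    obtain ⟨e₁, e₂, e₃⟩ := h.inj hP hP' (by linear_combination e)
    exact ⟨e₁, e₃, e₂⟩
  surj t := by
    obtain ⟨m, n, p, hP, e⟩ := h.surj t
    exact ⟨m, p, n, hP, by linear_combination e⟩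

theorem eq_zero_or_eq_zero (h : IsWeightSystem c P) {m n p : ℕ} (hP : P m n p) :
    n = 0 ∨ p = 0 := by
  by_contra! hnp
  have h₁ : P 0 1 1 := h.mono hP (by omega) (by omega) (by omega)
  have h₀ : P 0 0 0 := h.mono hP (by omega) (by omega) (by omega)
  have := h.inj h₁ h₀ (by push_cast; ring)
  omega

/-- The outer corner of a y-valley `(s, t)` has the weight of the highest power of `z`. -/
theorem weight_valley (h : IsWeightSystem c P) {s t k : ℕ} (hx : P (s + 1) t 0)
    (hy : P s (t + 1) 0) (hxy : ¬ P (s + 1) (t + 1) 0) (hk : P 0 0 k) (hk' : ¬ P 0 0 (k + 1)) :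
    (s + 1 : ZMod r) + c * (t + 1) = - c * k := by
  obtain ⟨m, n, p, hP, e⟩ := h.surj ((s + 1 : ZMod r) + c * (t + 1))
  have hm : m = 0 := by
    rcases m with _ | m
    · rfl
    · obtain ⟨rfl, rfl, rfl⟩ := h.inj (h.mono hP (Nat.le_succ m) le_rfl le_rfl) hy
        (by push_cast at e ⊢; linear_combination e)
      exact absurd hP hxy
  have hn : n = 0 := by
    rcases n with _ | n
    · rfl
    · obtain ⟨rfl, rfl, rfl⟩ := h.inj (h.mono hP le_rfl (Nat.le_succ n) le_rfl) hx
        (by push_cast at e ⊢; linear_combination e)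
      exact absurd hP hxy
  subst hm hn
  have hpk : p ≤ k := by
    by_contra! hlt
    exact hk' (h.mono hP le_rfl le_rfl hlt)
  rcases hpk.lt_or_eq with hlt | rfl
  · have := h.inj (h.mono hk le_rfl le_rfl (Nat.succ_le_of_lt hlt)) hx
      (by push_cast at e ⊢; linear_combination e)
    omega
  · push_cast at e ⊢
    linear_combination -e

/-- Left of the unique y-valley, all columns have full height. -/
theorem column_full (h : IsWeightSystem c P) {s t j : ℕ} (hy : P s (t + 1) 0) (hj : P 0 j 0)
    (hu : ∀ m n, P (m + 1) n 0 → P m (n + 1) 0 → ¬ P (m + 1) (n + 1) 0 → n = t) :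
    P s j 0 := by
  have key : ∀ m, m ≤ s → P m j 0 := by
    intro m
    induction m with
    | zero => exact fun _ => hj
    | succ m ih =>
      intro hm
      have hmj := ih (by omega)
      have climb : ∀ n, t + 1 ≤ n → n ≤ j → P (m + 1) n 0 := by
        intro n hn
        induction n, hn using Nat.le_induction with
        | base => exact fun _ => h.mono hy hm le_rfl le_rfl
        | succ n hn ihn =>
          intro hnj
          by_contra hcon
          have := hu m n (ihn (by omega)) (h.mono hmj le_rfl hnj le_rfl) hcon
          omega
      by_cases htj : t + 1 ≤ j
      · exact climb j htj le_rfl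
      · exact h.mono hy hm (by omega) le_rfl
  exact key s le_rfl

/-- The element with the weight of the first missing power of `x` is free of `x`. -/
theorem exists_weight_succ (h : IsWeightSystem c P) {i : ℕ} (hi : P i 0 0)
    (hi' : ¬ P (i + 1) 0 0) :
    ∃ n p, P 0 n p ∧ c * n - c * p = (i + 1 : ZMod r) := by
  obtain ⟨m, n, p, hP, e⟩ := h.surj (i + 1 : ZMod r)
  rcases m with _ | m
  · exact ⟨n, p, hP, by push_cast at e; linear_combination e⟩
  · obtain ⟨rfl, rfl, rfl⟩ := h.inj (h.mono hP (Nat.le_succ m) le_rfl le_rfl) hi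
      (by push_cast at e ⊢; linear_combination e)
    exact absurd hP hi'

/-- If all columns up to `s` are full in both the `y` and the `z` direction, then a monomial
`y^d` or `z^d` has the weight of `x^l`, `0 < l ≤ i + 1 + s`, only for `l = i + 1`. -/
theorem eq_succ_of_weight_eq (h : IsWeightSystem c P) {i j k d e l s : ℕ} (hi : P i 0 0)
    (hi' : ¬ P (i + 1) 0 0) (hj' : ¬ P 0 (j + 1) 0) (hk' : ¬ P 0 0 (k + 1))
    (hyfull : P s j 0) (hzfull : P s 0 k) (hde : P 0 d e) (hl : 0 < l) (hls : l ≤ i + 1 + s)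
    (hw : (l : ZMod r) = c * d - c * e) : l = i + 1 := by
  rcases lt_trichotomy l (i + 1) with hlt | heq | hgt
  · have := h.inj (h.mono hi (Nat.le_of_lt_succ hlt) le_rfl le_rfl) hde
      (by push_cast; linear_combination hw)
    omega
  · exact heq
  · obtain ⟨q, rfl⟩ : ∃ q, l = i + 1 + q := ⟨l - (i + 1), by omega⟩
    obtain ⟨n, p, hP, hnp⟩ := h.exists_weight_succ hi hi'
    have hn : n ≤ j := by
      by_contra! hlt
      exact hj' (h.mono hP le_rfl hlt (Nat.zero_le _))
    have hp : p ≤ k := by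
      by_contra! hlt
      exact hk' (h.mono hP le_rfl (Nat.zero_le _) hlt)
    have hq : P q n p := by
      rcases h.eq_zero_or_eq_zero hP with rfl | rfl
      · exact h.mono hzfull (by omega) le_rfl hp
      · exact h.mono hyfull (by omega) hn le_rfl
    have := h.inj hq hde (by push_cast at hw ⊢; linear_combination hw + hnp)
    omega

end IsWeightSystem

theorem IsGSet.isWeightSystem {r a : ℕ} {Γ : Set N3} (hΓ : IsGSet r a Γ) (har : a ≤ r) :
    IsWeightSystem (a : ZMod r) (fun m n p => (m, n, p) ∈ Γ) where
  mono {m n p m' n' p'} hP hm hn hp := by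
    refine (hΓ.dclosed (m', n', p') (m - m', n - n', p - p') ?_).1
    simpa [Nat.add_sub_cancel' hm, Nat.add_sub_cancel' hn, Nat.add_sub_cancel' hp] using hP
  inj hP hP' e := by
    have := hΓ.bij.injOn hP hP' (by rw [wtN_eq har, wtN_eq har, e])
    simpa using this
  surj t := by
    obtain ⟨⟨m, n, p⟩, hP, e⟩ := hΓ.bij.surjOn (Set.mem_univ t)
    exact ⟨m, n, p, hP, by rw [← wtN_eq har, e]⟩

theorem IsGSet.wtG_eq_s4 {r a : ℕ} {Γ : Set N3} (hΓ : IsGSet r a Γ) {v w : N3} (hw : w ∈ Γ)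
    (e : wtN r a w = wtN r a v) : wtG r a Γ v = w := by
  have h : ∃ w, w ∈ Γ ∧ wtN r a w = wtN r a v := ⟨w, hw, e⟩
  rw [wtG, dif_pos h]
  exact hΓ.bij.injOn h.choose_spec.1 hw (h.choose_spec.2.trans e.symm)

/-- Extremes in the case of two valleys. -/
theorem stmt4 (r a : ℕ) (hra : Nat.Coprime r a) (ha2 : 2 ≤ a) (halt : a < r - a) (Γ : Set N3) (hΓ : IsGSet r a Γ)
    (iy jy iz kz : ℕ)
    (hyv : IsYValley Γ iy jy) (hzv : IsZValley Γ iz kz)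
    (hyu : ∀ m n : ℕ, IsYValley Γ m n → (m, n) = (iy, jy))
    (hzu : ∀ m n : ℕ, IsZValley Γ m n → (m, n) = (iz, kz))
    (i j k : ℕ)
    (hi : (i, 0, 0) ∈ Γ ∧ (i + 1, 0, 0) ∉ Γ)
    (hj : (0, j, 0) ∈ Γ ∧ (0, j + 1, 0) ∉ Γ)
    (hk : (0, 0, k) ∈ Γ ∧ (0, 0, k + 1) ∉ Γ) :
    iy + iz + 1 = i ∧
    (k - kz ≤ j - jy → wtG r a Γ (i + 1, 0, 0) = (0, (j - jy) - (k - kz), 0)) ∧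
    (j - jy < k - kz → wtG r a Γ (i + 1, 0, 0) = (0, 0, (k - kz) - (j - jy))) := by
  have har : a ≤ r := by omega
  have h := hΓ.isWeightSystem har
  obtain ⟨-, hyx, hyy, hyn⟩ := hyv
  obtain ⟨-, hzx, hzz, hzn⟩ := hzv
  have wy := h.weight_valley hyx hyy hyn hk.1 hk.2
  have wz := h.swap.weight_valley hzx hzz hzn hj.1 hj.2
  have hyfull : (iy, j, 0) ∈ Γ := h.column_full hyy hj.1 fun m n h₁ h₂ h₃ =>
    congrArg Prod.snd (hyu m n ⟨h.mono h₁ (Nat.le_succ m) le_rfl le_rfl, h₁, h₂, h₃⟩)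
  have hzfull : (iz, 0, k) ∈ Γ := h.swap.column_full hzz hk.1 fun m n h₁ h₂ h₃ =>
    congrArg Prod.snd (hzu m n ⟨h.mono h₁ (Nat.le_succ m) le_rfl le_rfl, h₁, h₂, h₃⟩)
  have hjy : jy < j := by
    by_contra! hle
    exact hj.2 (h.mono hyy (Nat.zero_le _) (by omega) le_rfl)
  have hkz : kz < k := by
    by_contra! hle
    exact hk.2 (h.mono hzz (Nat.zero_le _) le_rfl (by omega))
  have hiy : iy < i := by
    by_contra! hle
    exact hi.2 (h.mono hyx (by omega) (Nat.zero_le _) le_rfl)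
  have hiz : iz < i := by
    by_contra! hle
    exact hi.2 (h.mono hzx (by omega) le_rfl (Nat.zero_le _))
  obtain ⟨u, rfl⟩ := Nat.exists_eq_add_of_le hjy.le
  obtain ⟨v, rfl⟩ := Nat.exists_eq_add_of_le hkz.le
  simp only [Nat.add_sub_cancel_left]
  have hw : ((iy + iz + 2 : ℕ) : ZMod r) = a * u - a * v := by
    push_cast at wy wz ⊢
    linear_combination wy + wz
  have hmin : (0, u - v, v - u) ∈ Γ := by
    rcases le_total v u with hle | hle
    · rw [Nat.sub_eq_zero_of_le hle]
      exact h.mono hj.1 le_rfl (by omega) le_rfl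
    · rw [Nat.sub_eq_zero_of_le hle]
      exact h.mono hk.1 le_rfl le_rfl (by omega)
  have hw' : ((iy + iz + 2 : ℕ) : ZMod r) = a * (u - v : ℕ) - a * (v - u : ℕ) := by
    rw [hw]
    rcases le_total v u with hle | hle <;> simp [Nat.sub_eq_zero_of_le hle, Nat.cast_sub hle] <;>
      ring
  have hl : iy + iz + 2 = i + 1 :=
    h.eq_succ_of_weight_eq (s := min iy iz) hi.1 hi.2 hj.2 hk.2
      (h.mono hyfull (min_le_left _ _) le_rfl le_rfl)
      (h.mono hzfull (min_le_right _ _) le_rfl le_rfl) hmin (by omega) (by omega) hw'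
  have hwt : wtG r a Γ (i + 1, 0, 0) = (0, u - v, v - u) := by
    refine hΓ.wtG_eq_s4 hmin ?_
    rw [wtN_eq har, wtN_eq har, ← hl, hw']
    push_cast
    ring
  refine ⟨by omega, fun hle => ?_, fun hlt => ?_⟩
  · rw [hwt, Nat.sub_eq_zero_of_le hle]
  · rw [hwt, Nat.sub_eq_zero_of_le hlt.le]

end GH
end
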